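/- Every C₃-free 1-planar finite simple graph on n ≥ 4 vertices has at most 3·(n − 2) edges. -/

import Mathlib

open unitInterval

/-- A (good) drawing of a simple graph in the plane: vertices map to distinct
points, each edge is drawn as a simple continuous arc between its endpoints,
arcs avoid vertex points other than their endpoints, two arcs meet in finitely
many points, and no three arcs pass through a common interior point. -/
structure PlaneDrawing {V : Type*} (G : SimpleGraph V) where
  pos : V → ℝ × ℝ
  pos_inj : Function.Injective pos
  arc : ∀ ⦃u v : V⦄, G.Adj u v → Path (pos u) (pos v)
  arc_symm : ∀ ⦃u v : V⦄ (h : G.Adj u v), arc h.symm = (arc h).symm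
  arc_inj : ∀ ⦃u v : V⦄ (h : G.Adj u v), Function.Injective (arc h)
  no_vertex_mem : ∀ ⦃u v : V⦄ (h : G.Adj u v) (w : V) (t : I),
      arc h t = pos w → w = u ∨ w = v
  finite_inter : ∀ ⦃u v x y : V⦄ (h₁ : G.Adj u v) (h₂ : G.Adj x y),
      s(u, v) ≠ s(x, y) →
      (Set.range (arc h₁) ∩ Set.range (arc h₂)).Finite
  no_triple_point : ∀ ⦃u₁ v₁ u₂ v₂ u₃ v₃ : V⦄
      (h₁ : G.Adj u₁ v₁) (h₂ : G.Adj u₂ v₂) (h₃ : G.Adj u₃ v₃),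
      s(u₁, v₁) ≠ s(u₂, v₂) → s(u₁, v₁) ≠ s(u₃, v₃) → s(u₂, v₂) ≠ s(u₃, v₃) →
      ∀ t₁ t₂ t₃ : I, t₁ ≠ 0 → t₁ ≠ 1 → t₂ ≠ 0 → t₂ ≠ 1 → t₃ ≠ 0 → t₃ ≠ 1 →
      arc h₁ t₁ = arc h₂ t₂ → arc h₂ t₂ = arc h₃ t₃ → False

namespace PlaneDrawing

variable {V : Type*} {G : SimpleGraph V} (D : PlaneDrawing G)

/-- `p` is an interior point of the arc of the edge `uv`. -/
def IsInteriorPoint {u v : V} (h : G.Adj u v) (p : ℝ × ℝ) : Prop :=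
  ∃ t : I, t ≠ 0 ∧ t ≠ 1 ∧ D.arc h t = p

/-- The set of crossing points of the drawing: points where the interiors of
the arcs of two distinct edges meet. -/
def crossings : Set (ℝ × ℝ) :=
  {p | ∃ (u v x y : V) (h₁ : G.Adj u v) (h₂ : G.Adj x y),
    s(u, v) ≠ s(x, y) ∧ D.IsInteriorPoint h₁ p ∧ D.IsInteriorPoint h₂ p}

/-- The number of crossings of the drawing. -/
noncomputable def crossingCount : ℕ := D.crossings.ncard

/-- The set of crossing points lying on the edge `uv`. -/
def edgeCrossings {u v : V} (h : G.Adj u v) : Set (ℝ × ℝ) :=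
  {p | D.IsInteriorPoint h p ∧
    ∃ (x y : V) (h₂ : G.Adj x y), s(u, v) ≠ s(x, y) ∧ D.IsInteriorPoint h₂ p}

/-- A drawing is `k`-plane if every edge is involved in at most `k` crossings. -/
def IsKPlane (k : ℕ) : Prop :=
  ∀ ⦃u v : V⦄ (h : G.Adj u v), (D.edgeCrossings h).ncard ≤ k

end PlaneDrawing

/-- The crossing number of a graph: the minimum number of crossings over all
drawings. -/
noncomputable def crossingNumber {V : Type*} (G : SimpleGraph V) : ℕ :=
  sInf {c : ℕ | ∃ D : PlaneDrawing G, D.crossingCount = c}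

/-- A graph is `k`-planar if it admits a drawing in which every edge is
involved in at most `k` crossings. -/
def KPlanar {V : Type*} (G : SimpleGraph V) (k : ℕ) : Prop :=
  ∃ D : PlaneDrawing G, D.IsKPlane k

/-- `G` has no cycle of length `ℓ`. -/
def HasNoCycleOfLength {V : Type*} (G : SimpleGraph V) (ℓ : ℕ) : Prop :=
  ∀ (v : V) (c : G.Walk v v), c.IsCycle → c.length ≠ ℓ

/-! ### Face structures on multigraphs and the resulting edge bound -/

section FaceStructure

open Finset

variable {V E : Type} [Fintype E] [DecidableEq V]

/-- The mod 2 boundary map of the multigraph with edge set `E` and endpoint maps `s`, `t`. -/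
def boundaryMap (s t : E → V) : (E → ZMod 2) →ₗ[ZMod 2] (V → ZMod 2) where
  toFun z v := ∑ e, z e * ((if s e = v then 1 else 0) + (if t e = v then 1 else 0))
  map_add' x y := by
    funext v
    simp only [Pi.add_apply, add_mul, sum_add_distrib]
  map_smul' c x := by
    funext v
    simp only [Pi.smul_apply, smul_eq_mul, mul_sum, mul_assoc, RingHom.id_apply]

/-- The edges of the multigraph have a face on each side so that the mod 2 cycles are exactly
the coboundaries of functions on the faces. -/
def HasFaces (s t : E → V) : Prop :=
  ∃ (F : Type) (l r : E → F),
    (∀ φ : F → ZMod 2, boundaryMap s t (fun e => φ (l e) + φ (r e)) = 0) ∧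
    ∀ z, boundaryMap s t z = 0 → ∃ φ : F → ZMod 2, z = fun e => φ (l e) + φ (r e)

lemma exists_other_edge {s t : E → V} (hloop : ∀ e, s e ≠ t e) {z : E → ZMod 2}
    (hz : boundaryMap s t z = 0) {e : E} (he : z e ≠ 0) {v : V} (hv : v ∈ s(s e, t e)) :
    ∃ e' w, e' ≠ e ∧ z e' ≠ 0 ∧ s(s e', t e') = s(v, w) := by
  by_contra! hcon
  have h0 : ∑ e, z e * ((if s e = v then 1 else 0) + (if t e = v then 1 else 0)) = 0 :=
    congrFun hz v
  rw [Finset.sum_eq_single e] at h0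
  · have := hloop e
    rcases Sym2.mem_iff.1 hv with rfl | rfl
    · simp_all [this.symm]
    · simp_all
  · intro e' _ hne
    by_cases hze : z e' = 0
    · simp [hze]
    · have h1 : s e' ≠ v := fun h => hcon e' (t e') hne hze (by rw [h])
      have h2 : t e' ≠ v := fun h => hcon e' (s e') hne hze (by rw [h, Sym2.eq_swap])
      simp [h1, h2]
  · simp

lemma four_le_card_support {s t : E → V} (hloop : ∀ e, s e ≠ t e)
    (htri : ∀ e₁ e₂ e₃ u v w, s(s e₁, t e₁) = s(u, v) → s(s e₂, t e₂) = s(v, w) →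
      s(s e₃, t e₃) = s(u, w) → False)
    (hinj : ∀ e e', s(s e, t e) = s(s e', t e') → e = e')
    {z : E → ZMod 2} (hz : boundaryMap s t z = 0) (hne : z ≠ 0) :
    4 ≤ #{e | z e ≠ 0} := by
  classical
  have hl : ∀ e a b, s(s e, t e) = s(a, b) → a ≠ b := by
    intro e a b h hab
    subst hab
    have := hloop e
    simp only [Sym2.eq_iff] at h
    rcases h with h | h <;> exact this (h.1.trans h.2.symm)
  obtain ⟨e, he⟩ := Function.ne_iff.1 hne
  obtain ⟨e₁, w, h1, hz1, hw⟩ := exists_other_edge hloop hz he (Sym2.mem_mk_left _ _)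
  obtain ⟨e₂, x, h2, hz2, hx⟩ := exists_other_edge hloop hz he (Sym2.mem_mk_right _ _)
  obtain ⟨e₃, y, h3, hz3, hy⟩ := exists_other_edge hloop hz hz1
    (v := w) (by rw [hw]; exact Sym2.mem_mk_right _ _)
  have hew : w ≠ t e := by
    rintro rfl
    exact h1 (hinj _ _ hw)
  have hsw := hl _ _ _ hw
  have hwx : w ≠ x := by
    rintro rfl
    exact htri e e₂ e₁ _ _ _ rfl hx hw
  have h12 : e₁ ≠ e₂ := by
    rintro rfl
    rw [hw, Sym2.eq_iff] at hx
    have := hloop e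
    tauto
  have h30 : e₃ ≠ e := by
    rintro rfl
    rw [Sym2.eq_iff] at hy
    rcases hy with h | h
    · exact hsw h.1
    · exact hew h.2.symm
  have h32 : e₃ ≠ e₂ := by
    rintro rfl
    rw [hx, Sym2.eq_iff] at hy
    rcases hy with h | h
    · exact hew h.1.symm
    · exact hwx h.2.symm
  have hsub : ({e, e₁, e₂, e₃} : Finset E) ⊆ ({e | z e ≠ 0} : Finset E) := by
    simp only [insert_subset_iff, singleton_subset_iff, mem_filter, mem_univ, true_and]
    exact ⟨he, hz1, hz2, hz3⟩
  refine le_trans ?_ (card_le_card hsub)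
  rw [card_insert_of_notMem, card_insert_of_notMem, card_insert_of_notMem, card_singleton]
  · simpa using h32.symm
  · simp [h12, h3.symm]
  · simp [h1.symm, h2.symm, h30.symm]

lemma card_lt_finrank_ker_add_card [Fintype V] [Nonempty V] (s t : E → V) :
    Fintype.card E + 1 ≤
      Module.finrank (ZMod 2) (LinearMap.ker (boundaryMap s t)) + Fintype.card V := by
  have h1 := (boundaryMap s t).finrank_range_add_finrank_ker
  rw [Module.finrank_fintype_fun_eq_card] at h1
  let φ : (V → ZMod 2) →ₗ[ZMod 2] ZMod 2 := ∑ v, LinearMap.proj v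
  have hφ : ∀ y, φ y = ∑ v, y v := fun y => by simp [φ]
  have hle : LinearMap.range (boundaryMap s t) ≤ LinearMap.ker φ := by
    rintro _ ⟨z, rfl⟩
    rw [LinearMap.mem_ker, hφ]
    change ∑ v, ∑ e, z e * ((if s e = v then 1 else 0) + (if t e = v then 1 else 0)) = 0
    rw [sum_comm]
    refine sum_eq_zero fun e _ => ?_
    rw [← mul_sum, sum_add_distrib]
    simp [CharTwo.add_self_eq_zero]
  have hlt : LinearMap.ker φ < ⊤ := by
    rw [lt_top_iff_ne_top]
    intro h
    have hv : Pi.single (Classical.arbitrary V) 1 ∈ LinearMap.ker φ := h ▸ Submodule.mem_top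
    rw [LinearMap.mem_ker, hφ] at hv
    simp at hv
  have h2 := Submodule.finrank_lt_finrank_of_lt (lt_of_le_of_lt hle hlt)
  rw [finrank_top, Module.finrank_fintype_fun_eq_card] at h2
  omega

/-- A triangle-free simple graph with a face structure on `n ≥ 3` vertices has at most
`2 n - 4` edges. -/
theorem HasFaces.card_add_four_le [Fintype V] {s t : E → V} (h : HasFaces s t)
    (hloop : ∀ e, s e ≠ t e)
    (htri : ∀ e₁ e₂ e₃ u v w, s(s e₁, t e₁) = s(u, v) → s(s e₂, t e₂) = s(v, w) →
      s(s e₃, t e₃) = s(u, w) → False)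
    (hinj : ∀ e e', s(s e, t e) = s(s e', t e') → e = e')
    (hV : 3 ≤ Fintype.card V) :
    Fintype.card E + 4 ≤ 2 * Fintype.card V := by
  classical
  obtain ⟨F, l, r, hF, hfill⟩ := h
  have : Nonempty V := Fintype.card_pos_iff.1 (by omega)
  have hdim := card_lt_finrank_ker_add_card s t
  let b : F → E → ZMod 2 := fun f e => (if l e = f then 1 else 0) + (if r e = f then 1 else 0)
  have hb : ∀ f, boundaryMap s t (b f) = 0 := fun f => hF fun g => if g = f then 1 else 0
  let K : Finset F := {f ∈ univ.image l ∪ univ.image r | b f ≠ 0}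
  have hbK : ∀ f ∉ K, b f = 0 := by
    intro f hf
    by_contra hbf
    obtain ⟨e, he⟩ := Function.ne_iff.1 hbf
    refine hf (mem_filter.2 ⟨?_, hbf⟩)
    by_contra hm
    simp only [mem_union, mem_image, mem_univ, true_and, not_or, not_exists] at hm
    exact he (by simp [b, hm.1 e, hm.2 e])
  have hspan : ∀ (z : E → ZMod 2) (φ : F → ZMod 2), (z = fun e => φ (l e) + φ (r e)) →
      z = ∑ f ∈ K, φ f • b f := by
    intro z φ hz
    have h1 : ∑ f ∈ K, φ f • b f = ∑ f ∈ univ.image l ∪ univ.image r, φ f • b f := by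
      refine sum_subset (filter_subset _ _) fun f _ hf => ?_
      rw [hbK f hf, smul_zero]
    rw [h1, hz]
    funext e
    simp only [b, Finset.sum_apply, Pi.smul_apply, smul_eq_mul, mul_add, mul_ite, mul_one, mul_zero,
      sum_add_distrib, sum_ite_eq]
    rw [if_pos (by simp), if_pos (by simp)]
  rcases K.eq_empty_or_nonempty with hK | ⟨f₀, hf₀⟩
  · have hker : LinearMap.ker (boundaryMap s t) = ⊥ := by
      rw [LinearMap.ker_eq_bot']
      intro z hz
      obtain ⟨φ, hφ⟩ := hfill z hz
      rw [hspan z φ hφ, hK, sum_empty]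
    rw [hker, finrank_bot] at hdim
    omega
  · have hle : LinearMap.ker (boundaryMap s t) ≤
        Submodule.span (ZMod 2) ((K.erase f₀).image b : Set (E → ZMod 2)) := by
      intro z hz
      obtain ⟨φ, hφ⟩ := hfill z hz
      rw [hspan z (fun f => φ f + φ f₀), ← add_sum_erase _ _ hf₀, CharTwo.add_self_eq_zero,
        zero_smul, zero_add]
      · refine Submodule.sum_mem _ fun f hf => Submodule.smul_mem _ _ (Submodule.subset_span ?_)
        exact mem_coe.2 (mem_image_of_mem _ hf)
      · rw [hφ]
        funext e
        rw [add_add_add_comm, CharTwo.add_self_eq_zero, add_zero]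
    have h1 := (Submodule.finrank_mono hle).trans (finrank_span_finset_le_card _)
    have h2 : #((K.erase f₀).image b) ≤ #K - 1 := card_image_le.trans (card_erase_of_mem hf₀).le
    have hKpos : 1 ≤ #K := card_pos.2 ⟨_, hf₀⟩
    have h3 : #K * 4 ≤ Fintype.card E * 2 := by
      refine card_mul_le_card_mul (s := K) (t := univ) (fun f e => b f e ≠ 0) ?_ ?_
      · intro f hf
        exact four_le_card_support hloop htri hinj (hb f) (mem_filter.1 hf).2
      · intro e _
        refine (card_le_card (t := {l e, r e}) ?_).trans card_le_two
        intro f hf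
        have hf' := (mem_filter.1 hf).2
        by_contra hm
        simp only [mem_insert, mem_singleton, not_or] at hm
        exact hf' (by simp [b, Ne.symm hm.1, Ne.symm hm.2])
    omega

end FaceStructure

/-! ### The integer grid and its minors -/

section Grid

open Finset

/-- The upper (right) endpoint of a grid edge: `(p, true)` is the vertical edge and `(p, false)`
the horizontal edge starting at `p`. -/
def gridTarget (a : (ℤ × ℤ) × Bool) : ℤ × ℤ :=
  if a.2 then (a.1.1, a.1.2 + 1) else (a.1.1 + 1, a.1.2)

/-- Cells are named by their lower left corner. The grid edge `a` separates the cell `a.1` from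
the cell `gridRight a`. -/
def gridRight (a : (ℤ × ℤ) × Bool) : ℤ × ℤ :=
  if a.2 then (a.1.1 - 1, a.1.2) else (a.1.1, a.1.2 - 1)

/-- The mod 2 boundary of a finite chain of grid edges. -/
noncomputable def gridBoundary : ((ℤ × ℤ) × Bool →₀ ZMod 2) →ₗ[ZMod 2] (ℤ × ℤ →₀ ZMod 2) :=
  Finsupp.linearCombination (ZMod 2)
    fun a => Finsupp.single a.1 1 + Finsupp.single (gridTarget a) 1

lemma gridBoundary_single (a : (ℤ × ℤ) × Bool) (c : ZMod 2) :
    gridBoundary (Finsupp.single a c) =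
      Finsupp.single a.1 c + Finsupp.single (gridTarget a) c := by
  simp [gridBoundary]

lemma gridBoundary_apply (z : (ℤ × ℤ) × Bool →₀ ZMod 2) (i j : ℤ) :
    gridBoundary z (i, j) =
      z ((i, j), false) + z ((i, j), true) + z ((i - 1, j), false) + z ((i, j - 1), true) := by
  induction z using Finsupp.induction_linear with
  | zero => simp
  | add f g hf hg =>
    rw [map_add, Finsupp.add_apply, hf, hg]
    simp only [Finsupp.add_apply]
    ring
  | single a c =>
    obtain ⟨⟨k, l⟩, b⟩ := a
    rw [gridBoundary_single]
    cases b <;> simp [gridTarget, Finsupp.single_apply, eq_sub_iff_add_eq]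

/-- Every finite cycle of the grid bounds a set of cells. -/
lemma exists_filling {z : (ℤ × ℤ) × Bool →₀ ZMod 2} (hz : gridBoundary z = 0) :
    ∃ φ : ℤ × ℤ → ZMod 2, ∀ a, z a = φ a.1 + φ (gridRight a) := by
  obtain ⟨N, hN⟩ : ∃ N : ℤ, ∀ a, a.1.2 < N → z a = 0 := by
    obtain ⟨N, hN⟩ := (z.support.image fun a => a.1.2).bddBelow
    refine ⟨N, fun a ha => ?_⟩
    by_contra h
    exact absurd (hN (mem_coe.2 (mem_image_of_mem _ (Finsupp.mem_support_iff.2 h)))) (not_le.2 ha)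
  let φ : ℤ × ℤ → ZMod 2 := fun p => ∑ k ∈ Icc N p.2, z ((p.1, k), false)
  have hstep : ∀ i j, φ (i, j) = z ((i, j), false) + φ (i, j - 1) := by
    intro i j
    rcases lt_or_ge j N with h | h
    · simp only [φ]
      rw [hN _ h, Icc_eq_empty (by omega), Icc_eq_empty (by omega)]
      simp
    · have h1 : Icc N j = insert j (Icc N (j - 1)) := by
        ext k
        simp only [mem_Icc, mem_insert]
        omega
      simp only [φ]
      rw [h1, sum_insert (by simp)]
  have hlow : ∀ i j, j < N → z ((i, j), true) = φ (i, j) + φ (i - 1, j) := by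
    intro i j h
    simp only [φ]
    rw [hN _ h, Icc_eq_empty (by omega)]
    simp
  have hvert : ∀ i j, z ((i, j), true) = φ (i, j) + φ (i - 1, j) := by
    intro i j
    rcases lt_or_ge j N with h | h
    · exact hlow i j h
    · have key : ∀ j, z ((i, j - 1), true) = φ (i, j - 1) + φ (i - 1, j - 1) →
          z ((i, j), true) = φ (i, j) + φ (i - 1, j) := by
        intro j ih
        have h0 := gridBoundary_apply z i j
        rw [hz, Finsupp.zero_apply, ih] at h0
        rw [hstep i j, hstep (i - 1) j]
        generalize z ((i, j), true) = a at *
        generalize z ((i, j), false) = b at *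
        generalize z ((i - 1, j), false) = c at *
        generalize φ (i, j - 1) = d at *
        generalize φ (i - 1, j - 1) = e at *
        clear * - h0
        revert a b c d e
        decide
      induction j, h using Int.leInduction with
      | base => exact key N (hlow i _ (by omega))
      | succ k _ ih => exact key _ (by simpa using ih)
  refine ⟨φ, ?_⟩
  rintro ⟨⟨i, j⟩, b⟩
  cases b
  · simp only [gridRight, Bool.false_eq_true, if_false]
    rw [hstep i j, add_assoc, CharTwo.add_self_eq_zero, add_zero]
  · simpa [gridRight] using hvert i j

/-- Adjacency in the grid. -/
def GridAdj (p q : ℤ × ℤ) : Prop :=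
  ∃ a : (ℤ × ℤ) × Bool, (a.1 = p ∧ gridTarget a = q) ∨ (a.1 = q ∧ gridTarget a = p)

lemma GridAdj.symm {p q : ℤ × ℤ} : GridAdj p q → GridAdj q p :=
  fun ⟨a, h⟩ => ⟨a, h.symm⟩

/-- The points `p` and `q` are joined by a grid walk inside `S`. -/
def GridReach (S : Set (ℤ × ℤ)) : ℤ × ℤ → ℤ × ℤ → Prop :=
  Relation.ReflTransGen fun p q => p ∈ S ∧ q ∈ S ∧ GridAdj p q

lemma GridReach.mono {S T : Set (ℤ × ℤ)} (h : S ⊆ T) {p q : ℤ × ℤ} (hpq : GridReach S p q) :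
    GridReach T p q :=
  Relation.ReflTransGen.mono (p := fun p q => p ∈ T ∧ q ∈ T ∧ GridAdj p q)
    (fun _ _ hab => ⟨h hab.1, h hab.2.1, hab.2.2⟩) _ _ hpq

lemma GridReach.symm {S : Set (ℤ × ℤ)} {p q : ℤ × ℤ} (h : GridReach S p q) : GridReach S q p := by
  have : Std.Symm fun p q => p ∈ S ∧ q ∈ S ∧ GridAdj p q :=
    ⟨fun _ _ hab => ⟨hab.2.1, hab.1, hab.2.2.symm⟩⟩
  exact Relation.ReflTransGen.stdSymm.symm _ _ h

lemma GridReach.exists_chain {S : Set (ℤ × ℤ)} {p q : ℤ × ℤ} (h : GridReach S p q) :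
    ∃ w, gridBoundary w = Finsupp.single p 1 + Finsupp.single q 1 ∧
      ∀ a, w a ≠ 0 → a.1 ∈ S ∧ gridTarget a ∈ S := by
  induction h with
  | refl => exact ⟨0, by rw [map_zero, ZModModule.add_self], by simp⟩
  | @tail q r _ hqr ih =>
    obtain ⟨w, hw, hS⟩ := ih
    obtain ⟨hq, hr, a, ha⟩ := hqr
    refine ⟨w + Finsupp.single a 1, ?_, ?_⟩
    · have h1 : Finsupp.single a.1 1 + Finsupp.single (gridTarget a) (1 : ZMod 2) =
          Finsupp.single q 1 + Finsupp.single r 1 := by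
        rcases ha with ⟨h1, h2⟩ | ⟨h1, h2⟩ <;> rw [h1, h2]
        rw [add_comm]
      rw [map_add, hw, gridBoundary_single, h1, add_assoc, ← add_assoc (Finsupp.single q 1),
        ZModModule.add_self, zero_add]
    · intro b hb
      by_cases hba : b = a
      · subst hba
        rcases ha with ⟨h1, h2⟩ | ⟨h1, h2⟩ <;> rw [h1, h2]
        exacts [⟨hq, hr⟩, ⟨hr, hq⟩]
      · refine hS b ?_
        simpa [Finsupp.single_apply, Ne.symm hba] using hb

/-- A simple graph that is a minor of the grid has a face structure. -/
theorem hasFaces_of_grid_minor {V E : Type} [Fintype V] [Fintype E] [DecidableEq V] {s t : E → V}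
    (hloop : ∀ e, s e ≠ t e) (hinj : ∀ e e', s(s e, t e) = s(s e', t e') → e = e')
    (B : V → Set (ℤ × ℤ)) (hfin : ∀ v, (B v).Finite)
    (hdisj : ∀ v w p, p ∈ B v → p ∈ B w → v = w) (b : V → ℤ × ℤ)
    (hconn : ∀ v, ∀ p ∈ B v, GridReach (B v) (b v) p)
    (hadj : ∀ e, ∃ p ∈ B (s e), ∃ q ∈ B (t e), GridAdj p q) : HasFaces s t := by
  classical
  choose p hp q hq h hh using hadj
  have hB : ∀ e v, ((if (h e).1 ∈ B v then 1 else 0) + (if gridTarget (h e) ∈ B v then 1 else 0) :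
      ZMod 2) = (if s e = v then 1 else 0) + (if t e = v then 1 else 0) := by
    intro e v
    have h1 : p e ∈ B v ↔ s e = v := ⟨fun h => hdisj _ _ _ (hp e) h, fun h => h ▸ hp e⟩
    have h2 : q e ∈ B v ↔ t e = v := ⟨fun h => hdisj _ _ _ (hq e) h, fun h => h ▸ hq e⟩
    rcases hh e with ⟨h3, h4⟩ | ⟨h3, h4⟩
    · simp only [h3, h4, h1, h2]
    · simp only [h3, h4, h1, h2]
      rw [add_comm]
  have hhinj : Function.Injective h := by
    intro e e' hee
    apply hinj
    rw [Sym2.eq_iff]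
    have h1 := hh e
    have h2 := hh e'
    rw [hee] at h1
    have hps := hp e
    have hqs := hq e
    rcases h1 with ⟨h1, h1'⟩ | ⟨h1, h1'⟩ <;> rcases h2 with ⟨h2, h2'⟩ | ⟨h2, h2'⟩
    · exact .inl ⟨hdisj _ _ _ (hp e) (by rw [← h1, h2]; exact hp e'),
        hdisj _ _ _ (hq e) (by rw [← h1', h2']; exact hq e')⟩
    · exact .inr ⟨hdisj _ _ _ (hp e) (by rw [← h1, h2]; exact hq e'),
        hdisj _ _ _ (hq e) (by rw [← h1', h2']; exact hp e')⟩
    · exact .inr ⟨hdisj _ _ _ (hp e) (by rw [← h1', h2']; exact hq e'),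
        hdisj _ _ _ (hq e) (by rw [← h1, h2]; exact hp e')⟩
    · exact .inl ⟨hdisj _ _ _ (hp e) (by rw [← h1', h2']; exact hp e'),
        hdisj _ _ _ (hq e) (by rw [← h1, h2]; exact hq e')⟩
  have hnot_both : ∀ e v, ¬ ((h e).1 ∈ B v ∧ gridTarget (h e) ∈ B v) := by
    rintro e v ⟨h1, h2⟩
    refine hloop e ?_
    rcases hh e with ⟨h3, h4⟩ | ⟨h3, h4⟩ <;> rw [h3] at h1 <;> rw [h4] at h2
    · exact (hdisj _ _ _ (hp e) h1).trans (hdisj _ _ _ (hq e) h2).symm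
    · exact (hdisj _ _ _ (hp e) h2).trans (hdisj _ _ _ (hq e) h1).symm
  let K : Set ((ℤ × ℤ) × Bool) :=
    {a | ∃ v, a.1 ∈ B v ∧ gridTarget a ∈ B v} ∪ Set.range h
  have hK : K.Finite := by
    refine (Set.Finite.subset ((Set.finite_iUnion hfin).prod (Set.finite_univ (α := Bool)))
      ?_).union (Set.finite_range h)
    rintro a ⟨v, hv, -⟩
    exact ⟨Set.mem_iUnion.2 ⟨v, hv⟩, trivial⟩
  let R : ℤ × ℤ → ℤ × ℤ → Prop := fun f f' => ∃ a ∉ K, a.1 = f ∧ gridRight a = f'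
  refine ⟨Quot R, fun e => Quot.mk R (h e).1, fun e => Quot.mk R (gridRight (h e)), ?_, ?_⟩
  · intro φ
    funext v
    let ψ : ℤ × ℤ → ZMod 2 := fun f => φ (Quot.mk R f)
    let g : (ℤ × ℤ) × Bool → ZMod 2 := fun a => ψ a.1 + ψ (gridRight a)
    have hg : ∀ a ∉ K, g a = 0 := by
      intro a ha
      have : ψ a.1 = ψ (gridRight a) := congrArg φ (Quot.sound ⟨a, ha, rfl, rfl⟩)
      simp only [g, this, CharTwo.add_self_eq_zero]
    let G : (ℤ × ℤ) × Bool →₀ ZMod 2 := Finsupp.onFinset hK.toFinset g fun a ha => by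
      by_contra hn
      exact ha (hg a (by simpa using hn))
    have hG : gridBoundary G = 0 := by
      ext ⟨i, j⟩
      rw [gridBoundary_apply]
      simp only [G, Finsupp.onFinset_apply, g, gridRight, Bool.false_eq_true, if_false, if_true,
        Finsupp.zero_apply]
      generalize ψ (i, j) = a
      generalize ψ (i, j - 1) = b
      generalize ψ (i - 1, j) = c
      generalize ψ (i - 1, j - 1) = d
      clear * -
      revert a b c d
      decide
    let Λ : (ℤ × ℤ →₀ ZMod 2) →ₗ[ZMod 2] ZMod 2 :=
      Finsupp.linearCombination (ZMod 2) fun x => if x ∈ B v then 1 else 0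
    have h1 : Λ (gridBoundary G) = ∑ a ∈ hK.toFinset,
        g a * ((if a.1 ∈ B v then 1 else 0) + (if gridTarget a ∈ B v then 1 else 0)) := by
      have h0 : gridBoundary G = ∑ a ∈ hK.toFinset,
          g a • (Finsupp.single a.1 1 + Finsupp.single (gridTarget a) (1 : ZMod 2)) :=
        Finsupp.sum_of_support_subset _ Finsupp.support_onFinset_subset _ (by simp)
      rw [h0, map_sum]
      refine sum_congr rfl fun a _ => ?_
      simp [Λ, mul_add]
    rw [hG, map_zero] at h1
    refine Eq.trans ?_ h1.symm
    refine sum_of_injOn h hhinj.injOn (fun e _ => by simp [K]) ?_ ?_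
    · intro a ha hna
      have ha' : a ∈ K := by simpa using ha
      rcases ha' with ⟨w, h2, h3⟩ | ⟨e, rfl⟩
      · by_cases hw : w = v
        · subst hw
          rw [if_pos h2, if_pos h3, CharTwo.add_self_eq_zero, mul_zero]
        · rw [if_neg fun h4 => hw (hdisj _ _ _ h2 h4), if_neg fun h4 => hw (hdisj _ _ _ h3 h4)]
          simp
      · exact absurd ⟨e, by simp, rfl⟩ hna
    · intro e _
      rw [hB]
  · intro z hz
    choose w₁ hw₁ hS₁ using fun e => (hconn (s e) (p e) (hp e)).exists_chain
    choose w₂ hw₂ hS₂ using fun e => (hconn (t e) (q e) (hq e)).exists_chain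
    let P : E → ((ℤ × ℤ) × Bool →₀ ZMod 2) := fun e => Finsupp.single (h e) 1 + w₁ e + w₂ e
    have hP : ∀ e, gridBoundary (P e) =
        Finsupp.single (b (s e)) 1 + Finsupp.single (b (t e)) 1 := by
      intro e
      have h1 : Finsupp.single (h e).1 1 + Finsupp.single (gridTarget (h e)) (1 : ZMod 2) =
          Finsupp.single (p e) 1 + Finsupp.single (q e) 1 := by
        rcases hh e with ⟨h1, h2⟩ | ⟨h1, h2⟩ <;> rw [h1, h2]
        rw [add_comm]
      have h2 : ∀ x y z w : ℤ × ℤ →₀ ZMod 2, x + y + (z + x) + (w + y) = z + w := by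
        intro x y z w
        have h3 : x + y + (z + x) + (w + y) = z + w + (x + x) + (y + y) := by abel
        rw [h3, ZModModule.add_self, ZModModule.add_self, add_zero, add_zero]
      simp only [P, map_add, gridBoundary_single, hw₁, hw₂, h1, h2]
    let Z := ∑ e, z e • P e
    have hZ : gridBoundary Z = 0 := by
      have h1 : gridBoundary Z = ∑ v, boundaryMap s t z v • Finsupp.single (b v) (1 : ZMod 2) := by
        simp only [Z, map_sum, map_smul, hP, boundaryMap, LinearMap.coe_mk, AddHom.coe_mk, sum_smul]
        rw [sum_comm]
        refine sum_congr rfl fun e _ => ?_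
        simp only [mul_smul, ← smul_sum, add_smul, sum_add_distrib, ite_smul, one_smul, zero_smul,
          sum_ite_eq, mem_univ, if_true]
      rw [h1, hz]
      simp
    obtain ⟨φ, hφ⟩ := exists_filling hZ
    have hZ0 : ∀ a ∉ K, Z a = 0 := by
      intro a ha
      simp only [Z, Finsupp.finsetSum_apply, Finsupp.smul_apply, smul_eq_mul]
      refine sum_eq_zero fun e _ => ?_
      have h1 : w₁ e a = 0 := by
        by_contra hne
        exact ha (.inl ⟨_, hS₁ e a hne⟩)
      have h2 : w₂ e a = 0 := by
        by_contra hne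
        exact ha (.inl ⟨_, hS₂ e a hne⟩)
      have h3 : h e ≠ a := fun h3 => ha (.inr ⟨e, h3⟩)
      simp [P, h1, h2, h3]
    have hZh : ∀ e, Z (h e) = z e := by
      intro e
      simp only [Z, Finsupp.finsetSum_apply, Finsupp.smul_apply, smul_eq_mul]
      have h1 : ∀ e', P e' (h e) = if e' = e then 1 else 0 := by
        intro e'
        have h1 : w₁ e' (h e) = 0 := by
          by_contra hne
          exact hnot_both e _ (hS₁ e' _ hne)
        have h2 : w₂ e' (h e) = 0 := by
          by_contra hne
          exact hnot_both e _ (hS₂ e' _ hne)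
        simp [P, h1, h2, Finsupp.single_apply, hhinj.eq_iff]
      simp [h1]
    refine ⟨Quot.lift φ ?_, ?_⟩
    · rintro f f' ⟨a, ha, rfl, rfl⟩
      have := hφ a
      rw [hZ0 a ha] at this
      exact CharTwo.add_eq_zero.1 this.symm
    · funext e
      rw [← hZh e, hφ]

end Grid

/-! ### Pixelation of compact connected sets -/

section Pixels

/-- The grid points at sup-distance at most one from the set `K` scaled by `N`. -/
def pixels (N : ℝ) (K : Set (ℝ × ℝ)) : Set (ℤ × ℤ) :=
  {p | ∃ x ∈ K, |N * x.1 - p.1| ≤ 1 ∧ |N * x.2 - p.2| ≤ 1}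

lemma gridReach_horizontal {S : Set (ℤ × ℤ)} {i i' j : ℤ} (h : i ≤ i')
    (hS : ∀ k, i ≤ k → k ≤ i' → (k, j) ∈ S) : GridReach S (i, j) (i', j) := by
  induction i', h using Int.leInduction with
  | base => exact .refl
  | succ k hk ih =>
    refine .tail (ih fun l h1 h2 => hS l h1 (by omega)) ⟨hS k hk (by omega), hS _ (by omega) le_rfl,
      ((k, j), false), .inl ⟨rfl, rfl⟩⟩

lemma gridReach_vertical {S : Set (ℤ × ℤ)} {i j j' : ℤ} (h : j ≤ j')
    (hS : ∀ k, j ≤ k → k ≤ j' → (i, k) ∈ S) : GridReach S (i, j) (i, j') := by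
  induction j', h using Int.leInduction with
  | base => exact .refl
  | succ k hk ih =>
    refine .tail (ih fun l h1 h2 => hS l h1 (by omega)) ⟨hS k hk (by omega), hS _ (by omega) le_rfl,
      ((i, k), true), .inl ⟨rfl, rfl⟩⟩

lemma gridReach_pixels_singleton (N : ℝ) (x : ℝ × ℝ) {p q : ℤ × ℤ} (hp : p ∈ pixels N {x})
    (hq : q ∈ pixels N {x}) : GridReach (pixels N {x}) p q := by
  obtain ⟨i, j⟩ := p
  obtain ⟨i', j'⟩ := q
  simp only [pixels, Set.mem_singleton_iff, exists_eq_left, Set.mem_ofPred_eq, abs_le] at hp hq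
  have between : ∀ {a b k : ℤ} {c : ℝ}, (-1 ≤ c - a ∧ c - a ≤ 1) → (-1 ≤ c - b ∧ c - b ≤ 1) →
      a ≤ k → k ≤ b → (-1 ≤ c - k ∧ c - k ≤ 1) := by
    intro a b k c h1 h2 h3 h4
    have h3' : (a : ℝ) ≤ k := by exact_mod_cast h3
    have h4' : (k : ℝ) ≤ b := by exact_mod_cast h4
    constructor <;> linarith
  have hor : ∀ k : ℤ, (-1 ≤ N * x.1 - k ∧ N * x.1 - k ≤ 1) → (k, j) ∈ pixels N {x} :=
    fun k hk => ⟨x, rfl, abs_le.2 hk, abs_le.2 hp.2⟩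
  have ver : ∀ k : ℤ, (-1 ≤ N * x.2 - k ∧ N * x.2 - k ≤ 1) → (i', k) ∈ pixels N {x} :=
    fun k hk => ⟨x, rfl, abs_le.2 hq.1, abs_le.2 hk⟩
  refine Relation.ReflTransGen.trans (b := (i', j)) ?_ ?_
  · rcases le_total i i' with h | h
    · exact gridReach_horizontal h fun k h1 h2 => hor k (between hp.1 hq.1 h1 h2)
    · exact (gridReach_horizontal h fun k h1 h2 => hor k (between hq.1 hp.1 h1 h2)).symm
  · rcases le_total j j' with h | h
    · exact gridReach_vertical h fun k h1 h2 => ver k (between hp.2 hq.2 h1 h2)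
    · exact (gridReach_vertical h fun k h1 h2 => ver k (between hq.2 hp.2 h1 h2)).symm

lemma pixels_mono (N : ℝ) {K L : Set (ℝ × ℝ)} (h : K ⊆ L) : pixels N K ⊆ pixels N L :=
  fun _ ⟨x, hx, h1⟩ => ⟨x, h hx, h1⟩

lemma gridReach_pixels {N : ℝ} {K : Set (ℝ × ℝ)} (hK : IsPreconnected K) {p q : ℤ × ℤ}
    (hp : p ∈ pixels N K) (hq : q ∈ pixels N K) : GridReach (pixels N K) p q := by
  obtain ⟨x, hx, hpx⟩ := hp
  obtain ⟨y, hy, hqy⟩ := hq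
  let P : ℝ × ℝ → ℝ × ℝ → Prop := fun x y =>
    ∀ p ∈ pixels N {x}, ∀ q ∈ pixels N {y}, GridReach (pixels N K) p q
  refine hK.induction₂ P ?_ ?_ ?_ hx hy p ⟨x, rfl, hpx⟩ q ⟨y, rfl, hqy⟩
  · intro x hx
    have h1 : ∀ᶠ y : ℝ × ℝ in nhdsWithin x K, |N * y.1 - N * x.1| < 1 / 2 ∧
        |N * y.2 - N * x.2| < 1 / 2 := by
      refine Filter.Eventually.filter_mono nhdsWithin_le_nhds (Filter.Eventually.and ?_ ?_)
      · have hc : Continuous fun y : ℝ × ℝ => |N * y.1 - N * x.1| := by fun_prop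
        exact hc.tendsto x |>.eventually (gt_mem_nhds (by simp))
      · have hc : Continuous fun y : ℝ × ℝ => |N * y.2 - N * x.2| := by fun_prop
        exact hc.tendsto x |>.eventually (gt_mem_nhds (by simp))
    filter_upwards [h1, self_mem_nhdsWithin] with y hy hyK
    have hr1 := abs_sub_round (N * x.1)
    have hr2 := abs_sub_round (N * x.2)
    have hxr : (round (N * x.1), round (N * x.2)) ∈ pixels N {x} :=
      ⟨x, rfl, hr1.trans (by norm_num), hr2.trans (by norm_num)⟩
    have hyr : (round (N * x.1), round (N * x.2)) ∈ pixels N {y} := by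
      refine ⟨y, rfl, ?_, ?_⟩
      · refine (abs_sub_le _ (N * x.1) _).trans ?_
        linarith [hy.1]
      · refine (abs_sub_le _ (N * x.2) _).trans ?_
        linarith [hy.2]
    exact fun p hp q hq =>
      ((gridReach_pixels_singleton N x hp hxr).mono (pixels_mono N (by simpa))).trans
        ((gridReach_pixels_singleton N y hyr hq).mono (pixels_mono N (by simpa)))
  · intro x y z _ hy _ hxy hyz p hp q hq
    have hyr : (round (N * y.1), round (N * y.2)) ∈ pixels N {y} :=
      ⟨y, rfl, (abs_sub_round _).trans (by norm_num), (abs_sub_round _).trans (by norm_num)⟩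
    exact (hxy p hp _ hyr).trans (hyz _ hyr q hq)
  · exact fun x y _ _ hxy p hp q hq => (hxy q hq p hp).symm

lemma pixels_finite (N : ℝ) {K : Set (ℝ × ℝ)} (hK : Bornology.IsBounded K) :
    (pixels N K).Finite := by
  obtain ⟨C, hC⟩ := hK.exists_norm_le
  have hfin : ((Set.Icc ⌊-(|N| * C + 1)⌋ ⌈|N| * C + 1⌉) ×ˢ
      (Set.Icc ⌊-(|N| * C + 1)⌋ ⌈|N| * C + 1⌉) : Set (ℤ × ℤ)).Finite :=
    (Set.finite_Icc _ _).prod (Set.finite_Icc _ _)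
  refine hfin.subset ?_
  rintro ⟨i, j⟩ ⟨x, hx, h1, h2⟩
  have hb : ∀ {u : ℝ} {k : ℤ}, |u| ≤ C → |N * u - k| ≤ 1 →
      k ∈ Set.Icc ⌊-(|N| * C + 1)⌋ ⌈|N| * C + 1⌉ := by
    intro u k hu hk
    have h3 : |N * u| ≤ |N| * C := by
      rw [abs_mul]
      exact mul_le_mul_of_nonneg_left hu (abs_nonneg _)
    rw [abs_le] at h3 hk
    constructor
    · have := Int.floor_le (-(|N| * C + 1))
      have h4 : (⌊-(|N| * C + 1)⌋ : ℝ) ≤ k := by linarith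
      exact_mod_cast h4
    · have := Int.le_ceil (|N| * C + 1)
      have h4 : (k : ℝ) ≤ ⌈|N| * C + 1⌉ := by linarith
      exact_mod_cast h4
  have hx' := hC x hx
  exact ⟨hb ((norm_fst_le x).trans hx') h1, hb ((norm_snd_le x).trans hx') h2⟩

lemma eventually_disjoint_pixels {K L : Set (ℝ × ℝ)} (hK : IsCompact K) (hL : IsCompact L)
    (h : Disjoint K L) : ∀ᶠ N : ℝ in Filter.atTop, Disjoint (pixels N K) (pixels N L) := by
  obtain ⟨r, hr, hKL⟩ := Metric.exists_pos_forall_lt_edist hK hL.isClosed h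
  have hr' : (0 : ℝ) < r := hr
  filter_upwards [Filter.eventually_ge_atTop (2 / (r : ℝ)), Filter.eventually_gt_atTop 0]
    with N hN hN0
  rw [Set.disjoint_left]
  rintro p ⟨x, hx, hx1, hx2⟩ ⟨y, hy, hy1, hy2⟩
  have hd := hKL x hx y hy
  rw [edist_dist, ENNReal.lt_ofReal_iff_toReal_lt ENNReal.coe_ne_top, ENNReal.coe_toReal,
    Prod.dist_eq, lt_max_iff, Real.dist_eq, Real.dist_eq] at hd
  rw [div_le_iff₀ hr'] at hN
  have key : ∀ {a b c : ℝ}, |N * a - c| ≤ 1 → |N * b - c| ≤ 1 → ¬ (r : ℝ) < |a - b| := by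
    intro a b c h1 h2 h3
    have h5 : N * |a - b| ≤ 2 := by
      have h4 : N * |a - b| = |N * a - N * b| := by
        rw [← mul_sub, abs_mul, abs_of_pos hN0]
      rw [h4]
      rw [abs_le] at h1 h2 ⊢
      constructor <;> linarith
    nlinarith
  exact hd.elim (key hx1 hy1) (key hx2 hy2)

lemma GridReach.mem {S : Set (ℤ × ℤ)} {p q : ℤ × ℤ} (h : GridReach S p q) (hp : p ∈ S) :
    q ∈ S := by
  induction h with
  | refl => exact hp
  | tail _ h _ => exact h.2.1

lemma GridReach.reach_component {S : Set (ℤ × ℤ)} {p q : ℤ × ℤ} (h : GridReach S p q) :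
    GridReach {x | GridReach S p x} p q := by
  induction h with
  | refl => exact .refl
  | tail h1 h2 ih => exact ih.tail ⟨h1, h1.tail h2, h2.2.2⟩

/-- A simple graph whose vertices and edges are represented by compact connected sets in the plane
that only meet at incidences has a face structure. -/
theorem hasFaces_of_connected_sets {V E : Type} [Fintype V] [Fintype E] [DecidableEq V]
    {s t : E → V} (hloop : ∀ e, s e ≠ t e) (hinj : ∀ e e', s(s e, t e) = s(s e', t e') → e = e')
    (S : V → Set (ℝ × ℝ)) (M : E → Set (ℝ × ℝ))
    (hS : ∀ v, IsCompact (S v)) (hSc : ∀ v, IsConnected (S v))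
    (hM : ∀ e, IsCompact (M e)) (hMc : ∀ e, IsPreconnected (M e))
    (hSS : ∀ v w, v ≠ w → Disjoint (S v) (S w)) (hMM : ∀ e e', e ≠ e' → Disjoint (M e) (M e'))
    (hMS : ∀ e v, v ≠ s e → v ≠ t e → Disjoint (M e) (S v))
    (hs : ∀ e, (M e ∩ S (s e)).Nonempty) (ht : ∀ e, (M e ∩ S (t e)).Nonempty) :
    HasFaces s t := by
  obtain ⟨N, hN1, hN2, hN3⟩ : ∃ N : ℝ,
      (∀ v w, v ≠ w → Disjoint (pixels N (S v)) (pixels N (S w))) ∧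
      (∀ e e', e ≠ e' → Disjoint (pixels N (M e)) (pixels N (M e'))) ∧
      (∀ e v, v ≠ s e → v ≠ t e → Disjoint (pixels N (M e)) (pixels N (S v))) := by
    refine Filter.Eventually.exists (f := Filter.atTop) ?_
    simp only [Filter.eventually_and, Filter.eventually_all]
    exact ⟨fun v w h => eventually_disjoint_pixels (hS v) (hS w) (hSS v w h),
      fun e e' h => eventually_disjoint_pixels (hM e) (hM e') (hMM e e' h),
      fun e v h h' => eventually_disjoint_pixels (hM e) (hS v) (hMS e v h h')⟩
  have hne : ∀ K : Set (ℝ × ℝ), K.Nonempty → (pixels N K).Nonempty := fun K ⟨x, hx⟩ =>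
    ⟨(round (N * x.1), round (N * x.2)), x, hx, (abs_sub_round _).trans (by norm_num),
      (abs_sub_round _).trans (by norm_num)⟩
  have hinter : ∀ K L : Set (ℝ × ℝ), pixels N (K ∩ L) ⊆ pixels N K ∩ pixels N L :=
    fun K L => Set.subset_inter (pixels_mono N Set.inter_subset_left)
      (pixels_mono N Set.inter_subset_right)
  let P : V → Set (ℤ × ℤ) := fun v => pixels N (S v)
  let Q : E → Set (ℤ × ℤ) := fun e => pixels N (M e)
  choose a ha using fun e => (hne _ (hs e)).mono (hinter _ _)
  choose c hc using fun e => (hne _ (ht e)).mono (hinter _ _)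
  choose b hb using fun v => hne _ (hSc v).nonempty
  have haQ : ∀ e, a e ∈ Q e \ P (t e) := fun e =>
    ⟨(ha e).1, fun h => Set.disjoint_left.1 (hN1 _ _ (hloop e)) (ha e).2 h⟩
  let R : E → Set (ℤ × ℤ) := fun e => {p | GridReach (Q e \ P (t e)) (a e) p}
  have hRQ : ∀ e, ∀ p ∈ R e, p ∈ Q e \ P (t e) := fun e p hp => GridReach.mem hp (haQ e)
  let B : V → Set (ℤ × ℤ) := fun v => {p | p ∈ P v ∨ ∃ e, s e = v ∧ p ∈ R e}
  have hPR : ∀ v e p, p ∈ P v → p ∈ R e → v = s e := by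
    intro v e p hpP hpR
    by_contra hv
    have h1 := hRQ e p hpR
    by_cases hvt : v = t e
    · exact h1.2 (hvt ▸ hpP)
    · exact Set.disjoint_left.1 (hN3 e v hv hvt) h1.1 hpP
  refine hasFaces_of_grid_minor hloop hinj B ?_ ?_ b ?_ ?_
  · intro v
    refine ((pixels_finite N (hS v).isBounded).union
      (Set.finite_iUnion fun e => pixels_finite N (hM e).isBounded)).subset ?_
    rintro p (hp | ⟨e, -, hp⟩)
    · exact .inl hp
    · exact .inr (Set.mem_iUnion.2 ⟨e, (hRQ e p hp).1⟩)
  · rintro v w p (hv | ⟨e, rfl, hv⟩) (hw | ⟨e', rfl, hw⟩)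
    · by_contra h
      exact Set.disjoint_left.1 (hN1 _ _ h) hv hw
    · exact hPR _ _ _ hv hw
    · exact (hPR _ _ _ hw hv).symm
    · by_contra h
      exact Set.disjoint_left.1 (hN2 e e' fun h' => h (congrArg s h')) (hRQ _ _ hv).1
        (hRQ _ _ hw).1
  · rintro v p (hp | ⟨e, rfl, hp⟩)
    · exact (gridReach_pixels (hSc v).isPreconnected (hb v) hp).mono fun _ => .inl
    · exact ((gridReach_pixels (hSc _).isPreconnected (hb _) (ha e).2).mono fun _ => .inl).trans
        (GridReach.reach_component hp |>.mono fun _ h => .inr ⟨e, rfl, h⟩)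
  · intro e
    have key : ∀ q, GridReach (Q e) (a e) q → q ∈ R e ∨
        ∃ p ∈ B (s e), ∃ q ∈ B (t e), GridAdj p q := by
      intro q hq
      induction hq with
      | refl => exact .inl .refl
      | @tail q r _ h2 ih =>
        rcases ih with ih | ih
        · by_cases hr : r ∈ P (t e)
          · exact .inr ⟨q, .inr ⟨e, rfl, ih⟩, r, .inl hr, h2.2.2⟩
          · exact .inl (Relation.ReflTransGen.tail ih ⟨hRQ e q ih, ⟨h2.2.1, hr⟩, h2.2.2⟩)
        · exact .inr ih
    exact (key (c e) (gridReach_pixels (hMc e) (ha e).1 (hc e).1)).resolve_left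
      fun h => (hRQ _ _ h).2 (hc e).2

end Pixels

/-! ### Systems of arcs -/

section Arcs

open Set

variable {V E : Type}

/-- A system of arcs whose interiors never pass through a vertex position. -/
structure ArcSystem (s t : E → V) (pos : V → ℝ × ℝ) (γ : E → ℝ → ℝ × ℝ) : Prop where
  loopless : ∀ e, s e ≠ t e
  simple : ∀ e e', s(s e, t e) = s(s e', t e') → e = e'
  pos_injective : Function.Injective pos
  continuousOn : ∀ e, ContinuousOn (γ e) (Icc 0 1)
  source : ∀ e, γ e 0 = pos (s e)
  target : ∀ e, γ e 1 = pos (t e)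
  eq_pos : ∀ e, ∀ x ∈ Icc (0 : ℝ) 1, ∀ v, γ e x = pos v → (x = 0 ∧ s e = v) ∨ (x = 1 ∧ t e = v)

/-- If any two arcs meet only within the parts before `α` and after `β` belonging to a common
endpoint, then the triangle-free graph they represent obeys the planar edge bound. -/
theorem ArcSystem.card_add_four_le [Fintype V] [Fintype E] {s t : E → V} {pos : V → ℝ × ℝ}
    {γ : E → ℝ → ℝ × ℝ} (hA : ArcSystem s t pos γ)
    (htri : ∀ e₁ e₂ e₃ u v w, s(s e₁, t e₁) = s(u, v) → s(s e₂, t e₂) = s(v, w) →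
      s(s e₃, t e₃) = s(u, w) → False)
    (hV : 3 ≤ Fintype.card V) (α β : E → ℝ) (hα : ∀ e, 0 < α e) (hαβ : ∀ e, α e < β e)
    (hβ : ∀ e, β e < 1)
    (hmeet : ∀ e e', ∀ x ∈ Icc (0 : ℝ) 1, ∀ y ∈ Icc (0 : ℝ) 1, γ e x = γ e' y →
      (e = e' ∧ x = y) ∨ ∃ v, ((s e = v ∧ x < α e) ∨ (t e = v ∧ β e < x)) ∧
        ((s e' = v ∧ y < α e') ∨ (t e' = v ∧ β e' < y))) :
    Fintype.card E + 4 ≤ 2 * Fintype.card V := by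
  classical
  refine HasFaces.card_add_four_le (s := s) (t := t) ?_ hA.loopless htri hA.simple hV
  let S : V → Set (ℝ × ℝ) := fun v => {pos v} ∪
    ⋃ e, ((⋃ _ : s e = v, γ e '' Icc 0 (α e)) ∪ ⋃ _ : t e = v, γ e '' Icc (β e) 1)
  let M : E → Set (ℝ × ℝ) := fun e => γ e '' Icc (α e) (β e)
  have hmemS : ∀ v q, q ∈ S v → q = pos v ∨ ∃ e, ∃ x ∈ Icc (0 : ℝ) 1, γ e x = q ∧
      ((s e = v ∧ x ≤ α e) ∨ (t e = v ∧ β e ≤ x)) := by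
    rintro v q (hq | hq)
    · exact .inl hq
    · right
      simp only [mem_iUnion, mem_union] at hq
      obtain ⟨e, ⟨h, x, hx, rfl⟩ | ⟨h, x, hx, rfl⟩⟩ := hq
      · exact ⟨e, x, ⟨hx.1, by linarith [hx.2, hαβ e, hβ e]⟩, rfl, .inl ⟨h, hx.2⟩⟩
      · exact ⟨e, x, ⟨by linarith [hx.1, hαβ e, hα e], hx.2⟩, rfl, .inr ⟨h, hx.1⟩⟩
  have hsub₁ : ∀ e, Icc 0 (α e) ⊆ Icc 0 1 := fun e =>
    Icc_subset_Icc_right (by linarith [hαβ e, hβ e])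
  have hsub₂ : ∀ e, Icc (β e) 1 ⊆ Icc 0 1 := fun e =>
    Icc_subset_Icc_left (by linarith [hαβ e, hα e])
  have hsub₃ : ∀ e, Icc (α e) (β e) ⊆ Icc 0 1 := fun e =>
    Icc_subset_Icc (hα e).le (hβ e).le
  have hS₁ : ∀ e, γ e '' Icc 0 (α e) ⊆ S (s e) := fun e q hq =>
    .inr (mem_iUnion.2 ⟨e, .inl (mem_iUnion.2 ⟨rfl, hq⟩)⟩)
  have hS₂ : ∀ e, γ e '' Icc (β e) 1 ⊆ S (t e) := fun e q hq =>
    .inr (mem_iUnion.2 ⟨e, .inr (mem_iUnion.2 ⟨rfl, hq⟩)⟩)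
  refine hasFaces_of_connected_sets hA.loopless hA.simple S M ?_ ?_ ?_ ?_ ?_ ?_ ?_ ?_ ?_
  · intro v
    refine isCompact_singleton.union (isCompact_iUnion fun e => ?_)
    exact (isCompact_iUnion fun _ =>
      isCompact_Icc.image_of_continuousOn ((hA.continuousOn e).mono (hsub₁ e))).union
      (isCompact_iUnion fun _ =>
        isCompact_Icc.image_of_continuousOn ((hA.continuousOn e).mono (hsub₂ e)))
  · intro v
    refine ⟨⟨pos v, .inl rfl⟩, isPreconnected_of_forall (pos v) ?_⟩
    rintro q (hq | hq)
    · exact ⟨{pos v}, subset_union_left, rfl, hq, isPreconnected_singleton⟩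
    · simp only [mem_iUnion, mem_union] at hq
      obtain ⟨e, ⟨rfl, hq⟩ | ⟨rfl, hq⟩⟩ := hq
      · exact ⟨_, hS₁ e, ⟨0, ⟨le_rfl, (hα e).le⟩, hA.source e⟩, hq,
          isPreconnected_Icc.image _ ((hA.continuousOn e).mono (hsub₁ e))⟩
      · exact ⟨_, hS₂ e, ⟨1, ⟨(hβ e).le, le_rfl⟩, hA.target e⟩, hq,
          isPreconnected_Icc.image _ ((hA.continuousOn e).mono (hsub₂ e))⟩
  · exact fun e => isCompact_Icc.image_of_continuousOn ((hA.continuousOn e).mono (hsub₃ e))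
  · exact fun e => isPreconnected_Icc.image _ ((hA.continuousOn e).mono (hsub₃ e))
  · intro v w hvw
    rw [Set.disjoint_left]
    intro q hv hw
    have hpa : ∀ v w e x, v ≠ w → x ∈ Icc (0 : ℝ) 1 → γ e x = pos v →
        ¬ ((s e = w ∧ x ≤ α e) ∨ (t e = w ∧ β e ≤ x)) := by
      rintro v w e x hvw hx he (⟨h1, h2⟩ | ⟨h1, h2⟩) <;>
        rcases hA.eq_pos e x hx v he with ⟨h3, h4⟩ | ⟨h3, h4⟩
      · exact hvw (h4.symm.trans h1)
      · linarith [hαβ e, hβ e]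
      · linarith [hαβ e, hα e]
      · exact hvw (h4.symm.trans h1)
    rcases hmemS v q hv with rfl | ⟨e, x, hx, rfl, h⟩
    · rcases hmemS w _ hw with h | ⟨e, x, hx, h, h'⟩
      · exact hvw (hA.pos_injective h)
      · exact hpa _ _ e x hvw hx h h'
    · rcases hmemS w _ hw with hq | ⟨e', y, hy, hxy, h'⟩
      · exact hpa _ _ e x hvw.symm hx hq h
      · rcases hmeet e e' x hx y hy hxy.symm with ⟨rfl, rfl⟩ | ⟨a, h1, h2⟩
        · rcases h with h | h <;> rcases h' with h' | h'
          · exact hvw (h.1.symm.trans h'.1)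
          · linarith [hαβ e, h.2, h'.2]
          · linarith [hαβ e, h.2, h'.2]
          · exact hvw (h.1.symm.trans h'.1)
        · have huniq : ∀ e v x, ((s e = v ∧ x ≤ α e) ∨ (t e = v ∧ β e ≤ x)) →
              ((s e = a ∧ x < α e) ∨ (t e = a ∧ β e < x)) → v = a := by
            rintro e v x (h | h) (h' | h')
            · exact h.1.symm.trans h'.1
            · linarith [hαβ e, h.2, h'.2]
            · linarith [hαβ e, h.2, h'.2]
            · exact h.1.symm.trans h'.1
          exact hvw ((huniq _ _ _ h h1).trans (huniq _ _ _ h' h2).symm)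
  · intro e e' hne
    rw [Set.disjoint_left]
    rintro _ ⟨x, hx, rfl⟩ ⟨y, hy, hxy⟩
    rcases hmeet e e' x (hsub₃ e hx) y (hsub₃ e' hy) hxy.symm with ⟨h, -⟩ | ⟨a, h | h, -⟩
    · exact hne h
    · linarith [hx.1, h.2]
    · linarith [hx.2, h.2]
  · intro e v hs ht
    rw [Set.disjoint_left]
    rintro _ ⟨x, hx, rfl⟩ hv
    rcases hmemS v _ hv with h | ⟨e', y, hy, hxy, h'⟩
    · rcases hA.eq_pos e x (hsub₃ e hx) v h with h | h
      · exact hs h.2.symm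
      · exact ht h.2.symm
    · rcases hmeet e e' x (hsub₃ e hx) y hy hxy.symm with ⟨rfl, rfl⟩ | ⟨a, h | h, -⟩
      · rcases h' with h' | h'
        · exact hs h'.1.symm
        · exact ht h'.1.symm
      · linarith [hx.1, h.2]
      · linarith [hx.2, h.2]
  · exact fun e => ⟨γ e (α e), ⟨α e, ⟨le_rfl, (hαβ e).le⟩, rfl⟩,
      hS₁ e ⟨α e, ⟨(hα e).le, le_rfl⟩, rfl⟩⟩
  · exact fun e => ⟨γ e (β e), ⟨β e, ⟨(hαβ e).le, le_rfl⟩, rfl⟩,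
      hS₂ e ⟨β e, ⟨le_rfl, (hβ e).le⟩, rfl⟩⟩

/-- A system of arcs in which every arc is injective and has at most one crossing, with a single
other arc. -/
structure OnePlaneArcSystem (s t : E → V) (pos : V → ℝ × ℝ) (γ : E → ℝ → ℝ × ℝ) : Prop
    extends ArcSystem s t pos γ where
  injOn : ∀ e, InjOn (γ e) (Icc 0 1)
  crossing_unique : ∀ e e' e'', e ≠ e' → e ≠ e'' → ∀ x ∈ Ioo (0 : ℝ) 1, ∀ x' ∈ Ioo (0 : ℝ) 1,
    ∀ y ∈ Ioo (0 : ℝ) 1, ∀ y' ∈ Ioo (0 : ℝ) 1, γ e x = γ e' y → γ e x' = γ e'' y' →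
    x = x' ∧ e' = e''

/-- The number of crossings between independent edges of a 1-plane drawing is at most `n - 2`.
The crossings are indexed by `R`; the crossing `r` involves the edges `f r true` and `f r false`
at the parameters `c r true` and `c r false`. -/
theorem OnePlaneArcSystem.card_crossings_le [Fintype V] {s t : E → V}
    {pos : V → ℝ × ℝ} {γ : E → ℝ → ℝ × ℝ} (hA : OnePlaneArcSystem s t pos γ)
    (hV : 3 ≤ Fintype.card V) {R : Type} [Fintype R] (f : R → Bool → E) (c : R → Bool → ℝ)
    (hc : ∀ r i, c r i ∈ Ioo (0 : ℝ) 1)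
    (hcross : ∀ r, γ (f r true) (c r true) = γ (f r false) (c r false))
    (hf : ∀ r r' i i', f r i = f r' i' → r = r' ∧ i = i')
    (hends : ∀ r v, v ∈ s(s (f r true), t (f r true)) → v ∉ s(s (f r false), t (f r false))) :
    Fintype.card R + 2 ≤ Fintype.card V := by
  let p : R → ℝ × ℝ := fun r => γ (f r true) (c r true)
  have hp : ∀ r i, γ (f r i) (c r i) = p r := fun r i => by
    cases i
    exacts [(hcross r).symm, rfl]
  have hIcc : ∀ {x : ℝ}, x ∈ Ioo (0 : ℝ) 1 → x ∈ Icc (0 : ℝ) 1 := fun h => Ioo_subset_Icc_self h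
  have hnotpos : ∀ e, ∀ x ∈ Ioo (0 : ℝ) 1, ∀ v, γ e x ≠ pos v := by
    intro e x hx v h
    rcases hA.eq_pos e x (hIcc hx) v h with h | h
    · linarith [hx.1, h.1]
    · linarith [hx.2, h.1]
  have hmem : ∀ e, ∀ x ∈ Icc (0 : ℝ) 1, (∀ v, γ e x ≠ pos v) → x ∈ Ioo (0 : ℝ) 1 := by
    intro e x hx h
    refine ⟨lt_of_le_of_ne hx.1 ?_, lt_of_le_of_ne hx.2 ?_⟩
    · rintro rfl
      exact h _ (hA.source e)
    · rintro rfl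
      exact h _ (hA.target e)
  have hkey : ∀ e, ∀ x ∈ Icc (0 : ℝ) 1, ∀ r, γ e x = p r → ∃ i, e = f r i ∧ x = c r i := by
    intro e x hx r h
    by_cases he : ∃ i, e = f r i
    · obtain ⟨i, rfl⟩ := he
      exact ⟨i, rfl, hA.injOn _ hx (hIcc (hc r i)) (h.trans (hp r i).symm)⟩
    · push Not at he
      have hx' := hmem e x hx fun v hv => hnotpos _ _ (hc r true) v (h.symm.trans hv)
      have := (hA.crossing_unique e _ _ (he true) (he false) x hx' x hx' _ (hc r true) _
        (hc r false) h (h.trans (hp r false).symm)).2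
      simpa using (hf _ _ _ _ this).2
  let d : Bool → ℝ := fun j => if j then 0 else 1
  let a : R × Bool × Bool → ℝ → ℝ := fun q u => c q.1 q.2.1 + u * (d q.2.2 - c q.1 q.2.1)
  let s' : R × Bool × Bool → V ⊕ R := fun q => .inr q.1
  let g : R × Bool × Bool → V := fun q => if q.2.2 then s (f q.1 q.2.1) else t (f q.1 q.2.1)
  let t' : R × Bool × Bool → V ⊕ R := fun q => .inl (g q)
  let γ' : R × Bool × Bool → ℝ → ℝ × ℝ := fun q u => γ (f q.1 q.2.1) (a q u)
  let pos' : V ⊕ R → ℝ × ℝ := Sum.elim pos p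
  have ha : ∀ q, ∀ u ∈ Icc (0 : ℝ) 1, a q u ∈ Icc (0 : ℝ) 1 := by
    rintro ⟨r, i, j⟩ u ⟨hu0, hu1⟩
    obtain ⟨h0, h1⟩ := hc r i
    cases j <;> simp only [a, d, Bool.false_eq_true, if_true, if_false] <;>
      constructor <;> nlinarith
  have ha_c : ∀ q u, a q u = c q.1 q.2.1 → u = 0 := by
    rintro ⟨r, i, j⟩ u h
    obtain ⟨h0, h1⟩ := hc r i
    have h2 : u * (d j - c r i) = 0 := by
      simp only [a] at h
      linarith
    rcases mul_eq_zero.1 h2 with h2 | h2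
    · exact h2
    · cases j <;> simp only [d, Bool.false_eq_true, if_true, if_false] at h2 <;> linarith
  have hγ_pos : ∀ q, ∀ u ∈ Icc (0 : ℝ) 1, ∀ v, γ' q u = pos v → u = 1 ∧ g q = v := by
    rintro ⟨r, i, j⟩ u hu v h
    obtain ⟨h0, h1⟩ := hc r i
    obtain ⟨hu0, hu1⟩ := hu
    rcases hA.eq_pos _ _ (ha _ u ⟨hu0, hu1⟩) v h with ⟨h2, h3⟩ | ⟨h2, h3⟩ <;>
      cases j <;> simp only [a, d, g, Bool.false_eq_true, if_true, if_false] at h2 h3 ⊢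
    · nlinarith
    · exact ⟨by nlinarith, h3⟩
    · exact ⟨by nlinarith, h3⟩
    · nlinarith
  have hA' : ArcSystem s' t' pos' γ' := by
    refine ⟨fun q => Sum.inr_ne_inl, ?_, ?_, ?_, ?_, ?_, ?_⟩
    · rintro ⟨r, i, j⟩ ⟨r', i', j'⟩ h
      have h1 : r = r' ∧ g (r, i, j) = g (r', i', j') := by
        simpa [s', t', Sym2.eq_iff] using h
      obtain ⟨rfl, h1⟩ := h1
      have hg : ∀ i j, g (r, i, j) ∈ s(s (f r i), t (f r i)) := by
        intro i j
        cases j <;> simp [g]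
      have hi : i = i' := by
        have h2 := hg i j
        have h3 := hg i' j'
        rw [← h1] at h3
        cases i <;> cases i' <;> first | rfl | exact absurd h2 (hends _ _ h3) |
          exact absurd h3 (hends _ _ h2)
      subst hi
      have hl := hA.loopless (f r i)
      have hj : j = j' := by
        cases j <;> cases j' <;> simp only [g, Bool.false_eq_true, if_true, if_false] at h1
        exacts [rfl, absurd h1.symm hl, absurd h1 hl, rfl]
      rw [hj]
    · rintro (v | r) (w | r') h
      · exact congrArg _ (hA.pos_injective h)
      · exact absurd h.symm (hnotpos _ _ (hc r' true) v)
      · exact absurd h (hnotpos _ _ (hc r true) w)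
      · obtain ⟨i, h1, -⟩ := hkey _ _ (hIcc (hc r true)) r' h
        rw [(hf _ _ _ _ h1).1]
    · intro q
      refine (hA.continuousOn _).comp (Continuous.continuousOn ?_) (ha q)
      simp only [a]
      fun_prop
    · rintro ⟨r, i, j⟩
      simp only [γ', a, zero_mul, add_zero]
      exact hp r i
    · rintro ⟨r, i, j⟩
      cases j
      · simpa [γ', a, d, t', g, pos'] using hA.target (f r i)
      · simpa [γ', a, d, t', g, pos'] using hA.source (f r i)
    · rintro q u hu (v | r) h
      · obtain ⟨h1, h2⟩ := hγ_pos q u hu v h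
        exact .inr ⟨h1, congrArg _ h2⟩
      · obtain ⟨i, h1, h2⟩ := hkey _ _ (ha q u hu) r h
        obtain ⟨h3, h4⟩ := hf _ _ _ _ h1
        refine .inl ⟨ha_c q u ?_, congrArg _ h3⟩
        rw [h2, h3, h4]
  have hcard := hA'.card_add_four_le ?_ (by rw [Fintype.card_sum]; omega)
    (fun _ => 1 / 3) (fun _ => 2 / 3) (by norm_num) (by norm_num) (by norm_num) ?_
  · simp only [Fintype.card_prod, Fintype.card_sum, Fintype.card_bool] at hcard
    omega
  · rintro e₁ e₂ e₃ (u | u) (v | v) (w | w) <;> simp [s', t']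
  · intro q q' u hu w hw h
    have hnear : u = 0 → w = 0 → q.1 = q'.1 → ∃ v, ((s' q = v ∧ u < 1 / 3) ∨
        (t' q = v ∧ 2 / 3 < u)) ∧ ((s' q' = v ∧ w < 1 / 3) ∨ (t' q' = v ∧ 2 / 3 < w)) := by
      rintro rfl rfl h
      exact ⟨s' q, .inl ⟨rfl, by norm_num⟩, .inl ⟨congrArg Sum.inr h.symm, by norm_num⟩⟩
    by_cases hpos : ∃ v, γ' q u = pos v
    · obtain ⟨v, hv⟩ := hpos
      obtain ⟨h1, h2⟩ := hγ_pos q u hu v hv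
      obtain ⟨h3, h4⟩ := hγ_pos q' w hw v (h.symm.trans hv)
      refine .inr ⟨.inl v, .inr ⟨congrArg _ h2, ?_⟩, .inr ⟨congrArg _ h4, ?_⟩⟩
      · rw [h1]; norm_num
      · rw [h3]; norm_num
    · push Not at hpos
      have hu' := hmem _ _ (ha q u hu) hpos
      have hw' := hmem _ _ (ha q' w hw) fun v hv => hpos v (h.trans hv)
      obtain ⟨r, i, j⟩ := q
      obtain ⟨r', i', j'⟩ := q'
      by_cases hff : f r i = f r' i'
      · obtain ⟨rfl, rfl⟩ := hf _ _ _ _ hff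
        have haa := hA.injOn _ (hIcc hu') (hIcc hw') h
        obtain ⟨h0, h1⟩ := hc r i
        by_cases hj : j = j'
        · subst hj
          refine .inl ⟨rfl, ?_⟩
          have h2 : (u - w) * (d j - c r i) = 0 := by
            simp only [a] at haa
            linarith
          rcases mul_eq_zero.1 h2 with h2 | h2
          · linarith
          · cases j <;> simp only [d, Bool.false_eq_true, if_true, if_false] at h2 <;> linarith
        · obtain ⟨hu0, -⟩ := hu
          obtain ⟨hw0, -⟩ := hw
          refine .inr (hnear ?_ ?_ rfl) <;> cases j <;> cases j' <;>
            simp only [a, d, Bool.false_eq_true, if_true, if_false, not_true] at haa hj <;>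
            nlinarith [mul_nonneg hu0 h0.le, mul_nonneg hw0 h0.le]
      · have hmate : ∀ r i, f r i ≠ f r (!i) := fun r i h => by
          simpa using (hf _ _ _ _ h).2
        have hcm : ∀ r i, γ (f r i) (c r i) = γ (f r (!i)) (c r (!i)) := fun r i =>
          (hp r i).trans (hp r _).symm
        obtain ⟨h1, h2⟩ := hA.crossing_unique _ _ _ hff (hmate r i) _ hu' _ (hc r i) _ hw' _
          (hc r _) h (hcm r i)
        obtain ⟨h3, -⟩ := hA.crossing_unique _ _ _ (Ne.symm hff) (hmate r' i') _ hw' _ (hc r' i') _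
          hu' _ (hc r' _) h.symm (hcm r' i')
        exact .inr (hnear (ha_c _ _ h1) (ha_c _ _ h3) (hf _ _ _ _ h2).1.symm)

end Arcs

/-! ### The edge bound for one-plane systems of arcs -/

section OnePlane

open Set

variable {V E : Type}

/-- Two distinct arcs cross if their interiors meet. -/
def ArcsCross (γ : E → ℝ → ℝ × ℝ) (e e' : E) : Prop :=
  e ≠ e' ∧ ∃ x ∈ Ioo (0 : ℝ) 1, ∃ y ∈ Ioo (0 : ℝ) 1, γ e x = γ e' y

theorem ArcsCross.symm {γ : E → ℝ → ℝ × ℝ} {e e' : E} (h : ArcsCross γ e e') :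
    ArcsCross γ e' e := by
  obtain ⟨hne, x, hx, y, hy, h⟩ := h
  exact ⟨hne.symm, y, hy, x, hx, h.symm⟩

theorem OnePlaneArcSystem.eq_of_arcsCross {s t : E → V} {pos : V → ℝ × ℝ} {γ : E → ℝ → ℝ × ℝ}
    (hA : OnePlaneArcSystem s t pos γ) {e e' e'' : E} (h : ArcsCross γ e e')
    (h' : ArcsCross γ e e'') : e' = e'' := by
  obtain ⟨hne, x, hx, y, hy, h⟩ := h
  obtain ⟨hne', x', hx', y', hy', h'⟩ := h'
  exact (hA.crossing_unique e e' e'' hne hne' x hx x' hx' y hy y' hy' h h').2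

theorem ArcSystem.eq_of_mem_of_mem {s t : E → V} {pos : V → ℝ × ℝ} {γ : E → ℝ → ℝ × ℝ}
    (hA : ArcSystem s t pos γ) {e e' : E} (hne : e ≠ e') {v w : V} (hv : v ∈ s(s e, t e))
    (hv' : v ∈ s(s e', t e')) (hw : w ∈ s(s e, t e)) (hw' : w ∈ s(s e', t e')) : v = w := by
  by_contra hvw
  exact hne (hA.simple e e' (((Sym2.mem_and_mem_iff hvw).1 ⟨hv, hw⟩).trans
    ((Sym2.mem_and_mem_iff hvw).1 ⟨hv', hw'⟩).symm))

/-- On every arc one can choose a middle part such that a crossing with an adjacent arc lies on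
the same side of it as the common endpoint. -/
theorem OnePlaneArcSystem.exists_middle {s t : E → V} {pos : V → ℝ × ℝ} {γ : E → ℝ → ℝ × ℝ}
    (hA : OnePlaneArcSystem s t pos γ) (e : E) :
    ∃ a b : ℝ, 0 < a ∧ a < b ∧ b < 1 ∧ ∀ e', e ≠ e' → ∀ x ∈ Ioo (0 : ℝ) 1, ∀ y ∈ Ioo (0 : ℝ) 1,
      γ e x = γ e' y → ∀ v, v ∈ s(s e, t e) → v ∈ s(s e', t e') →
        (s e = v ∧ x < a) ∨ (t e = v ∧ b < x) := by
  by_cases h : ∃ e' x y v, e ≠ e' ∧ x ∈ Ioo (0 : ℝ) 1 ∧ y ∈ Ioo (0 : ℝ) 1 ∧ γ e x = γ e' y ∧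
      v ∈ s(s e, t e) ∧ v ∈ s(s e', t e')
  · obtain ⟨e₁, x₁, y₁, v₁, hne₁, hx₁, hy₁, h₁, hv₁, hv₁'⟩ := h
    have huniq : ∀ e', e ≠ e' → ∀ x ∈ Ioo (0 : ℝ) 1, ∀ y ∈ Ioo (0 : ℝ) 1,
        γ e x = γ e' y → ∀ v, v ∈ s(s e, t e) → v ∈ s(s e', t e') → x = x₁ ∧ v = v₁ := by
      intro e' hne x hx y hy hxy v hv hv'
      obtain ⟨rfl, rfl⟩ := hA.crossing_unique e e' e₁ hne hne₁ x hx x₁ hx₁ y hy y₁ hy₁ hxy h₁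
      exact ⟨rfl, hA.toArcSystem.eq_of_mem_of_mem hne hv hv' hv₁ hv₁'⟩
    have ⟨h0, h1⟩ := hx₁
    rcases Sym2.mem_iff.1 hv₁ with hs | ht
    · refine ⟨x₁ + (1 - x₁) / 3, x₁ + 2 * (1 - x₁) / 3, by linarith, by linarith, by linarith,
        fun e' hne x hx y hy hxy v hv hv' => .inl ?_⟩
      obtain ⟨rfl, rfl⟩ := huniq e' hne x hx y hy hxy v hv hv'
      exact ⟨hs.symm, by linarith⟩
    · refine ⟨x₁ / 3, 2 * x₁ / 3, by linarith, by linarith, by linarith,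
        fun e' hne x hx y hy hxy v hv hv' => .inr ?_⟩
      obtain ⟨rfl, rfl⟩ := huniq e' hne x hx y hy hxy v hv hv'
      exact ⟨ht.symm, by linarith⟩
  · refine ⟨1 / 3, 2 / 3, by norm_num, by norm_num, by norm_num,
      fun e' hne x hx y hy hxy v hv hv' => ?_⟩
    exact absurd ⟨e', x, y, v, hne, hx, hy, hxy, hv, hv'⟩ h

/-- If crossing arcs always share an endpoint, then the planar edge bound holds. -/
theorem OnePlaneArcSystem.card_add_four_le [Fintype V] [Fintype E] {s t : E → V}
    {pos : V → ℝ × ℝ} {γ : E → ℝ → ℝ × ℝ} (hA : OnePlaneArcSystem s t pos γ)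
    (htri : ∀ e₁ e₂ e₃ u v w, s(s e₁, t e₁) = s(u, v) → s(s e₂, t e₂) = s(v, w) →
      s(s e₃, t e₃) = s(u, w) → False)
    (hV : 3 ≤ Fintype.card V)
    (hadj : ∀ e e', ArcsCross γ e e' → ∃ v, v ∈ s(s e, t e) ∧ v ∈ s(s e', t e')) :
    Fintype.card E + 4 ≤ 2 * Fintype.card V := by
  choose a b ha hab hb hmid using hA.exists_middle
  refine hA.toArcSystem.card_add_four_le htri hV a b ha hab hb ?_
  have hnear : ∀ e, ∀ x ∈ Icc (0 : ℝ) 1, ∀ v, γ e x = pos v →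
      (s e = v ∧ x < a e) ∨ (t e = v ∧ b e < x) := by
    intro e x hx v h
    rcases hA.eq_pos e x hx v h with ⟨rfl, h'⟩ | ⟨rfl, h'⟩
    exacts [.inl ⟨h', ha e⟩, .inr ⟨h', hb e⟩]
  have hend : ∀ e, ∀ x ∈ Icc (0 : ℝ) 1, x ∈ Ioo (0 : ℝ) 1 ∨ ∃ v, γ e x = pos v := by
    intro e x hx
    rcases eq_or_lt_of_le hx.1 with rfl | h0
    · exact .inr ⟨_, hA.source e⟩
    rcases eq_or_lt_of_le hx.2 with rfl | h1
    · exact .inr ⟨_, hA.target e⟩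
    exact .inl ⟨h0, h1⟩
  intro e e' x hx y hy hxy
  by_cases hne : e = e'
  · subst hne
    exact .inl ⟨rfl, hA.injOn e hx hy hxy⟩
  right
  rcases hend e x hx with hx' | ⟨v, hv⟩
  · rcases hend e' y hy with hy' | ⟨v, hv⟩
    · obtain ⟨v, hv, hv'⟩ := hadj e e' ⟨hne, x, hx', y, hy', hxy⟩
      exact ⟨v, hmid e e' hne x hx' y hy' hxy v hv hv',
        hmid e' e (Ne.symm hne) y hy' x hx' hxy.symm v hv' hv⟩
    · exact ⟨v, hnear e x hx v (hxy.trans hv), hnear e' y hy v hv⟩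
  · exact ⟨v, hnear e x hx v hv, hnear e' y hy v (hxy.symm.trans hv)⟩

theorem OnePlaneArcSystem.comp_injective {E' : Type} {s t : E → V} {pos : V → ℝ × ℝ}
    {γ : E → ℝ → ℝ × ℝ} (hA : OnePlaneArcSystem s t pos γ) {g : E' → E}
    (hg : Function.Injective g) : OnePlaneArcSystem (s ∘ g) (t ∘ g) pos (γ ∘ g) where
  loopless e := hA.loopless (g e)
  simple e e' h := hg (hA.simple _ _ h)
  pos_injective := hA.pos_injective
  continuousOn e := hA.continuousOn (g e)
  source e := hA.source (g e)
  target e := hA.target (g e)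
  eq_pos e := hA.eq_pos (g e)
  injOn e := hA.injOn (g e)
  crossing_unique e e' e'' h h' x hx x' hx' y hy y' hy' hxy hxy' := by
    have := hA.crossing_unique (g e) (g e') (g e'') (hg.ne h) (hg.ne h') x hx x' hx' y hy y' hy'
      hxy hxy'
    exact ⟨this.1, hg this.2⟩

/-- A triangle-free graph with a one-plane drawing on `n ≥ 3` vertices has at most `3 n - 6`
edges. -/
theorem OnePlaneArcSystem.card_add_six_le [Fintype V] [Fintype E] {s t : E → V}
    {pos : V → ℝ × ℝ} {γ : E → ℝ → ℝ × ℝ} (hA : OnePlaneArcSystem s t pos γ)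
    (htri : ∀ e₁ e₂ e₃ u v w, s(s e₁, t e₁) = s(u, v) → s(s e₂, t e₂) = s(v, w) →
      s(s e₃, t e₃) = s(u, w) → False)
    (hV : 3 ≤ Fintype.card V) :
    Fintype.card E + 6 ≤ 3 * Fintype.card V := by
  classical
  let rank := Fintype.equivFin E
  let R : Set E := {e | ∃ e', ArcsCross γ e e' ∧
    (∀ v, v ∈ s(s e, t e) → v ∉ s(s e', t e')) ∧ rank e < rank e'}
  have hR : Fintype.card R + 2 ≤ Fintype.card V := by
    choose π hπ hends hrank using fun r : R => r.2
    choose hne x hx y hy hxy using hπ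
    have hpR : ∀ r r' : R, (r : E) ≠ π r' := by
      intro r r' h
      have h₁ : ArcsCross γ (r : E) r' :=
        h ▸ ArcsCross.symm ⟨hne r', x r', hx r', y r', hy r', hxy r'⟩
      have h₂ := hA.eq_of_arcsCross h₁ ⟨hne r, x r, hx r, y r, hy r, hxy r⟩
      have h₃ := hrank r
      rw [← h₂, h] at h₃
      exact lt_asymm h₃ (hrank r')
    refine hA.card_crossings_le hV (fun r i => cond i (r : E) (π r))
      (fun r i => cond i (x r) (y r)) ?_ hxy ?_ hends
    · rintro r (_ | _)
      exacts [hy r, hx r]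
    · rintro r r' (_ | _) (_ | _) h
      · refine ⟨Subtype.ext (hA.eq_of_arcsCross (e := π r) ?_ ?_), rfl⟩
        · exact ArcsCross.symm ⟨hne r, x r, hx r, y r, hy r, hxy r⟩
        · have h' : π r = π r' := h
          rw [h']
          exact ArcsCross.symm ⟨hne r', x r', hx r', y r', hy r', hxy r'⟩
      · exact absurd h.symm (hpR r' r)
      · exact absurd h (hpR r r')
      · exact ⟨Subtype.ext h, rfl⟩
  have hRc : Fintype.card (Rᶜ : Set E) + 4 ≤ 2 * Fintype.card V := by
    refine (hA.comp_injective (g := ((↑) : (Rᶜ : Set E) → E))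
      Subtype.val_injective).card_add_four_le (fun e₁ e₂ e₃ => htri e₁ e₂ e₃) hV ?_
    rintro e e' ⟨hne, x, hx, y, hy, hxy⟩
    have hcr : ArcsCross γ (e : E) e' := ⟨fun h => hne (Subtype.ext h), x, hx, y, hy, hxy⟩
    by_contra! hno
    rcases lt_trichotomy (rank e) (rank e') with h | h | h
    · exact e.2 ⟨e', hcr, hno, h⟩
    · exact hcr.1 (rank.injective h)
    · exact e'.2 ⟨e, hcr.symm, fun v hv hv' => hno v hv' hv, h⟩
  have := Fintype.card_compl_set R
  have := set_fintype_card_le_univ R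
  omega

end OnePlane

/-! ### Plane drawings as systems of arcs -/

namespace PlaneDrawing

open Set

theorem edgeCrossings_finite {V : Type} [Finite V] {G : SimpleGraph V} (D : PlaneDrawing G)
    {u v : V} (h : G.Adj u v) : (D.edgeCrossings h).Finite := by
  have : (⋃ p : V × V, ⋃ h₂ : G.Adj p.1 p.2, ⋃ _ : s(u, v) ≠ s(p.1, p.2),
      range (D.arc h) ∩ range (D.arc h₂)).Finite :=
    finite_iUnion fun p => finite_iUnion fun h₂ => finite_iUnion fun hne =>
      D.finite_inter h h₂ hne
  refine this.subset ?_
  rintro _ ⟨⟨a, -, -, rfl⟩, x, y, h₂, hne, b, -, -, hb⟩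
  simp only [mem_iUnion]
  exact ⟨(x, y), h₂, hne, ⟨a, rfl⟩, ⟨b, hb⟩⟩

/-- The arcs of a `1`-plane drawing, each traversed in a chosen direction. -/
theorem IsKPlane.onePlaneArcSystem {V : Type} [Finite V] {G : SimpleGraph V}
    {D : PlaneDrawing G} (hD : D.IsKPlane 1) {s t : G.edgeSet → V}
    (hst : ∀ e : G.edgeSet, (e : Sym2 V) = s(s e, t e)) (hadj : ∀ e, G.Adj (s e) (t e)) :
    OnePlaneArcSystem s t D.pos fun e => (D.arc (hadj e)).extend := by
  have hext : ∀ e, ∀ x (hx : x ∈ Icc (0 : ℝ) 1),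
      (D.arc (hadj e)).extend x = D.arc (hadj e) ⟨x, hx⟩ := fun e x hx =>
    Path.extend_apply _ hx
  have hinj : ∀ e, InjOn (D.arc (hadj e)).extend (Icc (0 : ℝ) 1) := by
    intro e x hx y hy h
    simp only [hext e x hx, hext e y hy] at h
    exact congrArg Subtype.val (D.arc_inj _ h)
  have hsimple : ∀ e e', s(s e, t e) = s(s e', t e') → e = e' := fun e e' h =>
    Subtype.ext (((hst e).trans h).trans (hst e').symm)
  have hinterior : ∀ e, ∀ x ∈ Ioo (0 : ℝ) 1,
      D.IsInteriorPoint (hadj e) ((D.arc (hadj e)).extend x) := by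
    intro e x hx
    refine ⟨⟨x, Ioo_subset_Icc_self hx⟩, fun h => ?_, fun h => ?_, (hext e x _).symm⟩
    · exact hx.1.ne' (congrArg Subtype.val h)
    · exact hx.2.ne (congrArg Subtype.val h)
  refine { loopless := fun e => (hadj e).ne, simple := hsimple, pos_injective := D.pos_inj,
           continuousOn := fun e => (Path.continuous_extend _).continuousOn,
           source := fun e => Path.extend_zero _, target := fun e => Path.extend_one _,
           eq_pos := ?_, injOn := hinj, crossing_unique := ?_ }
  · intro e x hx v h
    rcases D.no_vertex_mem (hadj e) v ⟨x, hx⟩ ((hext e x hx).symm.trans h) with rfl | rfl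
    · exact .inl ⟨hinj e hx ⟨le_rfl, zero_le_one⟩ (h.trans (Path.extend_zero _).symm), rfl⟩
    · exact .inr ⟨hinj e hx ⟨zero_le_one, le_rfl⟩ (h.trans (Path.extend_one _).symm), rfl⟩
  · intro e e' e'' hne hne' x hx x' hx' y hy y' hy' hxy hxy'
    have hmem : ∀ f, e ≠ f → ∀ z ∈ Ioo (0 : ℝ) 1, ∀ w ∈ Ioo (0 : ℝ) 1,
        (D.arc (hadj e)).extend z = (D.arc (hadj f)).extend w →
        (D.arc (hadj e)).extend z ∈ D.edgeCrossings (hadj e) := fun f hf z hz w hw h =>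
      ⟨hinterior e z hz, s f, t f, hadj f, fun h => hf (hsimple _ _ h), h ▸ hinterior f w hw⟩
    have hpt := (ncard_le_one (D.edgeCrossings_finite (hadj e))).1 (hD (hadj e)) _
      (hmem e' hne x hx y hy hxy) _ (hmem e'' hne' x' hx' y' hy' hxy')
    refine ⟨hinj e (Ioo_subset_Icc_self hx) (Ioo_subset_Icc_self hx') hpt, ?_⟩
    by_contra hne''
    obtain ⟨a, ha0, ha1, ha⟩ := hinterior e x hx
    obtain ⟨b, hb0, hb1, hb⟩ := hinterior e' y hy
    obtain ⟨c, hc0, hc1, hc⟩ := hinterior e'' y' hy'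
    refine D.no_triple_point (hadj e) (hadj e') (hadj e'') (fun h => hne (hsimple _ _ h))
      (fun h => hne' (hsimple _ _ h)) (fun h => hne'' (hsimple _ _ h)) a b c ha0 ha1 hb0 hb1 hc0
      hc1 (ha.trans (hxy.trans hb.symm)) ?_
    rw [hb, hc, ← hxy, ← hxy', hpt]

end PlaneDrawing

theorem HasNoCycleOfLength.not_triangle {V : Type} {G : SimpleGraph V}
    (hG : HasNoCycleOfLength G 3) {u v w : V} (huv : G.Adj u v) (hvw : G.Adj v w)
    (huw : G.Adj u w) : False := by
  refine hG u (.cons huv (.cons hvw (.cons huw.symm .nil))) ?_ rfl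
  have h₁ := huv.ne
  have h₂ := hvw.ne
  have h₃ := huw.ne
  rw [SimpleGraph.Walk.cons_isCycle_iff]
  simp [SimpleGraph.Walk.cons_isPath_iff, h₁, h₂, h₃, h₁.symm, h₃.symm]

theorem stmt_4 {V : Type} [Fintype V] (G : SimpleGraph V)
    (hC3 : HasNoCycleOfLength G 3) (hG : KPlanar G 1)
    (hn : 4 ≤ Fintype.card V) :
    (G.edgeSet.ncard : ℝ) ≤ 3 * ((Fintype.card V : ℝ) - 2) := by
  classical
  obtain ⟨D, hD⟩ := hG
  have horient : ∀ e : G.edgeSet, ∃ p : V × V, (e : Sym2 V) = s(p.1, p.2) := fun e =>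
    Sym2.ind (f := fun z => ∃ p : V × V, z = s(p.1, p.2)) (fun a b => ⟨(a, b), rfl⟩) (e : Sym2 V)
  choose p hp using horient
  have hadj : ∀ e, G.Adj (p e).1 (p e).2 := fun e => by
    rw [← SimpleGraph.mem_edgeSet, ← hp]
    exact e.2
  have hmem : ∀ (e : G.edgeSet) {u v}, s((p e).1, (p e).2) = s(u, v) → G.Adj u v :=
    fun e u v h => by
      rw [← SimpleGraph.mem_edgeSet, ← h, ← hp]
      exact e.2
  have hcard := (hD.onePlaneArcSystem hp hadj).card_add_six_le
    (fun e₁ e₂ e₃ u v w h₁ h₂ h₃ => hC3.not_triangle (hmem e₁ h₁) (hmem e₂ h₂) (hmem e₃ h₃))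
    (by omega)
  have hE : G.edgeSet.ncard = Fintype.card G.edgeSet := by
    rw [← Nat.card_coe_set_eq, Nat.card_eq_fintype_card]
  have hreal : (G.edgeSet.ncard : ℝ) + 6 ≤ 3 * Fintype.card V := by
    rw [hE]
    exact_mod_cast hcard
  linarith
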